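/- For every real $m \geq 1$, one has $\sum_{q \geq 2} \frac{\Lambda(q)}{q \log(mq) \log(2mq)} \leq \frac{1}{\log(2m)}$, where the sum is over natural numbers $q \geq 2$. -/

import Mathlib

open ArithmeticFunction MeasureTheory Set

lemma LSeries_term_ofReal (f : ℕ → ℝ) {σ : ℝ} (hσ : σ ≠ 0) :
    LSeries.term (fun n ↦ (f n : ℂ)) σ = fun n : ℕ ↦ ((f n / (n : ℝ) ^ σ : ℝ) : ℂ) := by
  ext n
  rw [LSeries.term_of_ne_zero' (by exact_mod_cast hσ), Complex.ofReal_div,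
    Complex.ofReal_cpow n.cast_nonneg, Complex.ofReal_natCast]

lemma summable_div_rpow_of_LSeriesSummable {f : ℕ → ℝ} {σ : ℝ} (hσ : σ ≠ 0)
    (hf : LSeriesSummable (fun n ↦ (f n : ℂ)) σ) : Summable fun n : ℕ ↦ f n / (n : ℝ) ^ σ := by
  rw [LSeriesSummable, LSeries_term_ofReal f hσ] at hf
  exact Complex.summable_ofReal.mp hf

lemma LSeries_ofReal (f : ℕ → ℝ) {σ : ℝ} (hσ : σ ≠ 0) :
    LSeries (fun n ↦ (f n : ℂ)) σ = ((∑' n : ℕ, f n / (n : ℝ) ^ σ : ℝ) : ℂ) := by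
  rw [LSeries, LSeries_term_ofReal f hσ, Complex.ofReal_tsum]

lemma summable_vonMangoldt_div_rpow {σ : ℝ} (hσ : 1 < σ) :
    Summable fun n : ℕ ↦ Λ n / (n : ℝ) ^ σ :=
  summable_div_rpow_of_LSeriesSummable (by linarith)
    (LSeriesSummable_vonMangoldt (by simpa using hσ))

lemma summable_log_div_rpow {σ : ℝ} (hσ : 1 < σ) :
    Summable fun n : ℕ ↦ Real.log n / (n : ℝ) ^ σ := by
  refine summable_div_rpow_of_LSeriesSummable (by linarith) ?_
  have h := (LSeriesSummable_vonMangoldt (s := σ) (by simpa using hσ)).convolution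
    (LSeriesSummable_one_iff.mpr (by simpa using hσ))
  rw [convolution_vonMangoldt_const_one] at h
  simpa only [Complex.natCast_log] using h

/-- The Dirichlet series form of `Λ * ζ = log` on the real half-line `σ > 1`. -/
lemma tsum_vonMangoldt_div_rpow_mul_tsum {σ : ℝ} (hσ : 1 < σ) :
    (∑' n : ℕ, Λ n / (n : ℝ) ^ σ) * ∑' n : ℕ, 1 / (n : ℝ) ^ σ =
      ∑' n : ℕ, Real.log n / (n : ℝ) ^ σ := by
  have hσ0 : σ ≠ 0 := by linarith
  have h := LSeries_convolution' (s := σ) (LSeriesSummable_vonMangoldt (by simpa using hσ))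
    (LSeriesSummable_one_iff.mpr (by simpa using hσ))
  rw [convolution_vonMangoldt_const_one] at h
  have h1 : (1 : ℕ → ℂ) = fun n ↦ (((fun _ ↦ 1 : ℕ → ℝ) n : ℝ) : ℂ) := by ext; simp
  have hlog : (fun n : ℕ ↦ Complex.log n) = fun n : ℕ ↦ (((fun k : ℕ ↦ Real.log k) n : ℝ) : ℂ) := by
    ext; rw [Complex.natCast_log]
  rw [h1, hlog, LSeries_ofReal _ hσ0, LSeries_ofReal _ hσ0, LSeries_ofReal _ hσ0] at h
  exact_mod_cast h.symm

lemma log_div_rpow_one_add {x : ℝ} (hx : 0 < x) (s : ℝ) :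
    Real.log x / x ^ (1 + s) = Real.log x / x * Real.exp (-(s * Real.log x)) := by
  rw [Real.rpow_add hx, Real.rpow_one, Real.rpow_def_of_pos hx s, Real.exp_neg, mul_comm s,
    div_mul_eq_div_div, div_eq_mul_inv (Real.log x / x)]

/-- The first two pairs of terms of the alternating series of `log n / n ^ σ`. -/
lemma log_div_rpow_three_add_five_le {σ : ℝ} (hσ : 1 ≤ σ) :
    Real.log 3 / (3 : ℝ) ^ σ + Real.log 5 / (5 : ℝ) ^ σ ≤
      Real.log 2 / (2 : ℝ) ^ σ + Real.log 4 / (4 : ℝ) ^ σ := by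
  obtain ⟨s, rfl⟩ : ∃ s, σ = 1 + s := ⟨σ - 1, by ring⟩
  have hs : 0 ≤ s := by linarith
  have h4 : Real.log 4 = 2 * Real.log 2 := by
    rw [show (4 : ℝ) = 2 ^ 2 by norm_num, Real.log_pow]; norm_num
  have h3 : 3 * Real.log 2 ≤ 2 * Real.log 3 := by
    have : Real.log ((2 : ℝ) ^ 3) ≤ Real.log ((3 : ℝ) ^ 2) :=
      Real.log_le_log (by norm_num) (by norm_num)
    simpa [Real.log_pow] using this
  have h5 : 2 * Real.log 2 ≤ Real.log 5 := h4 ▸ Real.log_le_log (by norm_num) (by norm_num)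
  have h52 : 2 * Real.log 5 ≤ 5 * Real.log 2 := by
    have : Real.log ((5 : ℝ) ^ 2) ≤ Real.log ((2 : ℝ) ^ 5) :=
      Real.log_le_log (by norm_num) (by norm_num)
    simpa [Real.log_pow] using this
  have h35 : 5 * Real.log 3 + 3 * Real.log 5 ≤ 15 * Real.log 2 := by
    have : Real.log ((3 : ℝ) ^ 5 * 5 ^ 3) ≤ Real.log ((2 : ℝ) ^ 15) :=
      Real.log_le_log (by norm_num) (by norm_num)
    rw [Real.log_mul (by norm_num) (by norm_num)] at this
    simpa [Real.log_pow] using this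
  have hlog2 : 0 < Real.log 2 := Real.log_pos (by norm_num)
  rw [log_div_rpow_one_add (by norm_num), log_div_rpow_one_add (by norm_num),
    log_div_rpow_one_add (by norm_num), log_div_rpow_one_add (by norm_num), h4]
  obtain ⟨z, hz⟩ : ∃ z, z = Real.exp (-(s * Real.log 2 / 2)) := ⟨_, rfl⟩
  have hz0 : 0 < z := hz ▸ Real.exp_pos _
  have hz1 : z ≤ 1 := by
    rw [hz, Real.exp_le_one_iff]; have := mul_nonneg hs hlog2.le; linarith
  have e (k : ℕ) : z ^ k = Real.exp (-(s * (k * Real.log 2 / 2))) := by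
    rw [hz, ← Real.exp_nat_mul]; congr 1; ring
  have e2 : Real.exp (-(s * Real.log 2)) = z ^ 2 := by
    rw [e]; congr 1; push_cast; ring
  have e4 : Real.exp (-(s * (2 * Real.log 2))) = z ^ 4 := by
    rw [e]; congr 1; push_cast; ring
  have e3 : Real.exp (-(s * Real.log 3)) ≤ z ^ 3 := by
    rw [e, Real.exp_le_exp, neg_le_neg_iff]
    exact mul_le_mul_of_nonneg_left (by push_cast; linarith) hs
  have e5 : Real.exp (-(s * Real.log 5)) ≤ z ^ 4 := by
    rw [e, Real.exp_le_exp, neg_le_neg_iff]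
    exact mul_le_mul_of_nonneg_left (by push_cast; linarith) hs
  rw [e2, e4]
  have key : Real.log 3 / 3 * z + Real.log 5 / 5 * z ^ 2 ≤
      Real.log 2 / 2 + Real.log 2 / 2 * z ^ 2 := by
    have hf : 0 ≤ (1 - z) * (Real.log 2 / 2 * (1 - z) + Real.log 5 / 5 * z) := by
      have : 0 ≤ 1 - z := by linarith
      have : 0 ≤ Real.log 5 := by linarith
      positivity
    have hg : 0 ≤ z * (15 * Real.log 2 - 5 * Real.log 3 - 3 * Real.log 5) :=
      mul_nonneg hz0.le (by linarith)
    linarith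
  calc Real.log 3 / 3 * Real.exp (-(s * Real.log 3)) + Real.log 5 / 5 * Real.exp (-(s * Real.log 5))
      ≤ Real.log 3 / 3 * z ^ 3 + Real.log 5 / 5 * z ^ 4 := by
        have : 0 ≤ Real.log 3 := by linarith
        have : 0 ≤ Real.log 5 := by linarith
        gcongr
    _ = z ^ 2 * (Real.log 3 / 3 * z + Real.log 5 / 5 * z ^ 2) := by ring
    _ ≤ z ^ 2 * (Real.log 2 / 2 + Real.log 2 / 2 * z ^ 2) := by gcongr
    _ = Real.log 2 / 2 * z ^ 2 + 2 * Real.log 2 / 4 * z ^ 4 := by ring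

lemma tsum_log_div_rpow_odd_le_even {σ : ℝ} (hσ : 1 < σ) :
    ∑' k : ℕ, Real.log (2 * k + 1 : ℕ) / ((2 * k + 1 : ℕ) : ℝ) ^ σ ≤
      ∑' k : ℕ, Real.log (2 * k : ℕ) / ((2 * k : ℕ) : ℝ) ^ σ := by
  have hs := summable_log_div_rpow hσ
  have he : Summable fun k : ℕ ↦ Real.log (2 * k : ℕ) / ((2 * k : ℕ) : ℝ) ^ σ :=
    hs.comp_injective (i := fun k ↦ 2 * k) fun a b h ↦ by simpa using h
  have ho : Summable fun k : ℕ ↦ Real.log (2 * k + 1 : ℕ) / ((2 * k + 1 : ℕ) : ℝ) ^ σ :=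
    hs.comp_injective (i := fun k ↦ 2 * k + 1) fun a b h ↦ by simpa using h
  rw [← he.sum_add_tsum_nat_add 3, ← ho.sum_add_tsum_nat_add 3]
  refine add_le_add ?_ ?_
  · have h := log_div_rpow_three_add_five_le hσ.le
    norm_num [Finset.sum_range_succ]
    exact h
  · refine Summable.tsum_le_tsum (fun k ↦ ?_) ((summable_nat_add_iff 3).mpr ho)
      ((summable_nat_add_iff 3).mpr he)
    have hbase : Real.exp σ⁻¹ ≤ ((2 * (k + 3) : ℕ) : ℝ) := by
      have h1 : Real.exp σ⁻¹ ≤ Real.exp 1 := Real.exp_le_exp.mpr (inv_le_one_of_one_le₀ hσ.le)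
      have h2 := Real.exp_one_lt_d9
      push_cast
      linarith [k.cast_nonneg (α := ℝ)]
    have hle : ((2 * (k + 3) : ℕ) : ℝ) ≤ ((2 * (k + 3) + 1 : ℕ) : ℝ) := by
      exact_mod_cast Nat.le_succ _
    exact Real.log_div_self_rpow_antitoneOn (by linarith) hbase (hbase.trans hle) hle

/-- An upper bound for `-ζ'/ζ`, equivalent to the Dirichlet eta function increasing on
`(1, ∞)`. -/
lemma tsum_vonMangoldt_div_rpow_mul_le {s : ℝ} (hs : 0 < s) :
    (∑' n : ℕ, Λ n / (n : ℝ) ^ (1 + s)) * (1 - (2 : ℝ) ^ (-s)) ≤ Real.log 2 * (2 : ℝ) ^ (-s) := by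
  have hσ : 1 < 1 + s := by linarith
  have hz : Summable fun n : ℕ ↦ 1 / (n : ℝ) ^ (1 + s) := Real.summable_one_div_nat_rpow.mpr hσ
  have hl := summable_log_div_rpow hσ
  have hzpos : 0 < ∑' n : ℕ, 1 / (n : ℝ) ^ (1 + s) :=
    hz.tsum_pos (fun n ↦ by positivity) 1 (by simp)
  have hprod := tsum_vonMangoldt_div_rpow_mul_tsum hσ
  have heven : 2 * ∑' k : ℕ, Real.log (2 * k : ℕ) / ((2 * k : ℕ) : ℝ) ^ (1 + s) =
      (2 : ℝ) ^ (-s) * (Real.log 2 * ∑' n : ℕ, 1 / (n : ℝ) ^ (1 + s) +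
        ∑' n : ℕ, Real.log n / (n : ℝ) ^ (1 + s)) := by
    rw [← tsum_mul_left (a := Real.log 2), ← (hz.mul_left _).tsum_add hl, ← tsum_mul_left, ← tsum_mul_left]
    refine tsum_congr fun k ↦ ?_
    rcases Nat.eq_zero_or_pos k with rfl | hk
    · simp [Real.zero_rpow (by linarith : 1 + s ≠ 0)]
    · have hk : (0 : ℝ) < k := by exact_mod_cast hk
      have h2 : (0 : ℝ) < 2 ^ s := by positivity
      push_cast
      rw [Real.log_mul two_ne_zero hk.ne', Real.mul_rpow two_pos.le hk.le, Real.rpow_neg two_pos.le,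
        Real.rpow_add two_pos, Real.rpow_one]
      field_simp
  have hsplit : (∑' k : ℕ, Real.log (2 * k : ℕ) / ((2 * k : ℕ) : ℝ) ^ (1 + s)) +
      ∑' k : ℕ, Real.log (2 * k + 1 : ℕ) / ((2 * k + 1 : ℕ) : ℝ) ^ (1 + s) =
      ∑' n : ℕ, Real.log n / (n : ℝ) ^ (1 + s) :=
    tsum_even_add_odd (f := fun n : ℕ ↦ Real.log n / (n : ℝ) ^ (1 + s))
      (hl.comp_injective (i := fun k ↦ 2 * k) fun a b h ↦ by simpa using h)
      (hl.comp_injective (i := fun k ↦ 2 * k + 1) fun a b h ↦ by simpa using h)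
  have hle := tsum_log_div_rpow_odd_le_even hσ
  refine le_of_mul_le_mul_right ?_ hzpos
  rw [mul_right_comm, hprod]
  linarith

lemma integrableOn_rpow_neg_Ioi {a : ℝ} (ha : 1 < a) :
    IntegrableOn (fun s : ℝ ↦ a ^ (-s)) (Ioi 0) := by
  have h := integrableOn_exp_mul_Ioi (neg_neg_of_pos (Real.log_pos ha)) 0
  refine h.congr_fun (fun s _ ↦ ?_) measurableSet_Ioi
  simp only [Real.rpow_def_of_pos (zero_lt_one.trans ha)]
  congr 1; ring

lemma integral_rpow_neg_Ioi {a : ℝ} (ha : 1 < a) :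
    ∫ s in Ioi (0 : ℝ), a ^ (-s) = 1 / Real.log a := by
  have h := integral_exp_mul_Ioi (neg_neg_of_pos (Real.log_pos ha)) 0
  rw [mul_zero, Real.exp_zero, neg_div_neg_eq] at h
  rw [← h]
  refine setIntegral_congr_fun measurableSet_Ioi fun s _ ↦ ?_
  simp only [Real.rpow_def_of_pos (zero_lt_one.trans ha)]
  congr 1; ring

lemma one_div_log_mul_log_two_mul {x : ℝ} (hx : 1 < x) :
    1 / (Real.log x * Real.log (2 * x)) =
      (∫ s in Ioi (0 : ℝ), (x ^ (-s) - (2 * x) ^ (-s))) / Real.log 2 := by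
  have hx2 : 1 < 2 * x := by linarith
  rw [integral_sub (integrableOn_rpow_neg_Ioi hx) (integrableOn_rpow_neg_Ioi hx2),
    integral_rpow_neg_Ioi hx, integral_rpow_neg_Ioi hx2]
  have h1 := Real.log_pos hx
  have h2 : 0 < Real.log 2 := Real.log_pos one_lt_two
  have h3 : Real.log (2 * x) = Real.log 2 + Real.log x :=
    Real.log_mul two_ne_zero (by linarith)
  rw [h3]
  field_simp
  ring

theorem vonMangoldt_shifted_nonasymptotic_estimate (m : ℝ) (hm : 1 ≤ m) :
    (∑' q : ℕ, if 2 ≤ q then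
        ArithmeticFunction.vonMangoldt q /
          ((q : ℝ) * Real.log (m * q) * Real.log (2 * m * q)) else 0) ≤
      1 / Real.log (2 * m) := by
  have hm0 : 0 < m := by linarith
  have hlog2 : 0 < Real.log 2 := Real.log_pos one_lt_two
  have hmq {q : ℕ} (hq : 2 ≤ q) : 1 < m * q := by
    have : (2 : ℝ) ≤ q := by exact_mod_cast hq
    nlinarith
  refine Real.tsum_le_of_sum_le (fun q ↦ ?_) fun F ↦ ?_
  · dsimp only [Pi.zero_apply]
    split_ifs with hq
    · have h1 := Real.log_pos (hmq hq)
      have h2 : 0 < Real.log (2 * m * q) := Real.log_pos (by linarith [hmq hq])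
      have := vonMangoldt_nonneg (n := q)
      positivity
    · rfl
  rw [← Finset.sum_filter]
  set G := F.filter (2 ≤ ·)
  have hG2 {q : ℕ} (hq : q ∈ G) : 2 ≤ q := (Finset.mem_filter.mp hq).2
  have hint (q : ℕ) (hq : q ∈ G) : IntegrableOn
      (fun s : ℝ ↦ Λ q / q * ((m * q) ^ (-s) - (2 * (m * q)) ^ (-s))) (Ioi 0) :=
    ((integrableOn_rpow_neg_Ioi (hmq (hG2 hq))).sub
      (integrableOn_rpow_neg_Ioi (by linarith [hmq (hG2 hq)]))).const_mul _
  have hm2 : 1 < 2 * m := by linarith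
  calc ∑ q ∈ G, Λ q / ((q : ℝ) * Real.log (m * q) * Real.log (2 * m * q))
      = (∑ q ∈ G, ∫ s in Ioi (0 : ℝ),
          Λ q / q * ((m * q) ^ (-s) - (2 * (m * q)) ^ (-s))) / Real.log 2 := by
        rw [Finset.sum_div]
        refine Finset.sum_congr rfl fun q hq ↦ ?_
        rw [integral_const_mul, mul_div_assoc, ← one_div_log_mul_log_two_mul (hmq (hG2 hq)),
          div_mul_div_comm, mul_one]
        ring_nf
    _ = (∫ s in Ioi (0 : ℝ), ∑ q ∈ G,
          Λ q / q * ((m * q) ^ (-s) - (2 * (m * q)) ^ (-s))) / Real.log 2 := by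
        rw [integral_finsetSum _ hint]
    _ ≤ (∫ s in Ioi (0 : ℝ), Real.log 2 * (2 * m) ^ (-s)) / Real.log 2 := by
        refine div_le_div_of_nonneg_right ?_ hlog2.le
        refine setIntegral_mono_on (integrable_finsetSum _ hint)
          ((integrableOn_rpow_neg_Ioi hm2).const_mul _) measurableSet_Ioi fun s hs ↦ ?_
        have hs : 0 < s := hs
        have h2s : (2 : ℝ) ^ (-s) ≤ 1 := Real.rpow_le_one_of_one_le_of_nonpos one_le_two (by linarith)
        have hterm : ∑ q ∈ G, Λ q / q * ((m * q) ^ (-s) - (2 * (m * q)) ^ (-s)) =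
            m ^ (-s) * ((∑ q ∈ G, Λ q / (q : ℝ) ^ (1 + s)) * (1 - (2 : ℝ) ^ (-s))) := by
          rw [Finset.sum_mul, Finset.mul_sum]
          refine Finset.sum_congr rfl fun q hq ↦ ?_
          have hq0 : (0 : ℝ) < q := by exact_mod_cast two_pos.trans_le (hG2 hq)
          rw [Real.mul_rpow two_pos.le (by positivity), Real.mul_rpow hm0.le hq0.le,
            Real.rpow_neg hq0.le, Real.rpow_add hq0, Real.rpow_one, div_mul_eq_div_div]
          ring
        rw [hterm, Real.mul_rpow two_pos.le hm0.le]
        calc m ^ (-s) * ((∑ q ∈ G, Λ q / (q : ℝ) ^ (1 + s)) * (1 - (2 : ℝ) ^ (-s)))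
            ≤ m ^ (-s) * ((∑' q : ℕ, Λ q / (q : ℝ) ^ (1 + s)) * (1 - (2 : ℝ) ^ (-s))) := by
              refine mul_le_mul_of_nonneg_left (mul_le_mul_of_nonneg_right ?_ (by linarith))
                (by positivity)
              exact (summable_vonMangoldt_div_rpow (by linarith)).sum_le_tsum _ fun q _ ↦
                div_nonneg vonMangoldt_nonneg (by positivity)
          _ ≤ m ^ (-s) * (Real.log 2 * (2 : ℝ) ^ (-s)) :=
              mul_le_mul_of_nonneg_left (tsum_vonMangoldt_div_rpow_mul_le hs) (by positivity)
          _ = Real.log 2 * ((2 : ℝ) ^ (-s) * m ^ (-s)) := by ring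
    _ = 1 / Real.log (2 * m) := by
        rw [integral_const_mul, integral_rpow_neg_Ioi hm2]
        field_simp
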